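/- The determinant polynomial Q^{(i)}_{n,n} satisfies Q^{(i)}_{n,n}(y) = γ_n P_{n−i}(y) for i = 1,...,min(r,n). -/

import Mathlib

open Polynomial

/-- `B_n^{(i)} = ∑_{j=i}^{r} a_{n-i+j,j} A_{n-i+j+1}` (componentwise). -/
noncomputable def Bvec (r : ℕ) (a : ℕ → ℕ → ℂ) (A : ℕ → Fin r → Polynomial ℂ)
    (n i : ℕ) (k : Fin r) : Polynomial ℂ :=
  ∑ j ∈ Finset.Icc i r, a (n + j - i) j • A (n + j - i + 1) k

/-- `Q^{(i)}_{k,n} = det(B_n^{(1)},…,B_n^{(i-1)}, A_k, B_n^{(i+1)},…,B_n^{(r)})`. -/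
noncomputable def Qdet (r : ℕ) (a : ℕ → ℕ → ℂ) (A : ℕ → Fin r → Polynomial ℂ)
    (n k i : ℕ) : Polynomial ℂ :=
  Matrix.det (Matrix.of fun row col : Fin r =>
    if col.val + 1 = i then A k row else Bvec r a A n (col.val + 1) row)

theorem Bvec_succ_succ {r : ℕ} (a : ℕ → ℕ → ℂ) (A : ℕ → Fin r → ℂ[X]) (n : ℕ) {i : ℕ}
    (hi : i ≤ r) (k : Fin r) :
    Bvec r a A n i k = a n i • A (n + 1) k + Bvec r a A (n + 1) (i + 1) k := by
  unfold Bvec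
  rw [← Finset.add_sum_Ioc_eq_sum_Icc hi, ← Finset.Icc_add_one_left_eq_Ioc]
  simp only [Nat.add_sub_cancel]
  congr 1
  refine Finset.sum_congr rfl fun j hj => ?_
  rw [Finset.mem_Icc] at hj
  rw [show n + 1 + j - (i + 1) = n + j - i by omega]

theorem Bvec_of_lt {r : ℕ} (a : ℕ → ℕ → ℂ) (A : ℕ → Fin r → ℂ[X]) (n : ℕ) {i : ℕ}
    (hi : r < i) (k : Fin r) : Bvec r a A n i k = 0 := by
  unfold Bvec
  rw [Finset.Icc_eq_empty (by omega), Finset.sum_empty]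

/-- The recurrence for `A`, solved for `B_{n+1}^{(1)}`. -/
theorem Bvec_one {r : ℕ} {a : ℕ → ℕ → ℂ} {A : ℕ → Fin r → ℂ[X]}
    (hArec : ∀ n, 1 ≤ n → ∀ k : Fin r,
      X * A n k = A (n - 1) k +
        ∑ j ∈ Finset.range (r + 1), a (n + j - 1) j • A (n + j) k)
    (n : ℕ) (k : Fin r) :
    Bvec r a A (n + 1) 1 k = X * A (n + 1) k - A n k - a n 0 • A (n + 1) k := by
  rw [hArec (n + 1) (by omega) k, Finset.range_eq_Ico,
    Finset.sum_eq_sum_Ico_succ_bot (by omega)]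
  unfold Bvec
  rw [show Finset.Icc 1 r = Finset.Ico (0 + 1) (r + 1) by rfl]
  have : ∑ j ∈ Finset.Ico (0 + 1) (r + 1), a (n + 1 + j - 1) j • A (n + 1 + j - 1 + 1) k =
      ∑ j ∈ Finset.Ico (0 + 1) (r + 1), a (n + 1 + j - 1) j • A (n + 1 + j) k :=
    Finset.sum_congr rfl fun j hj => by
      rw [show n + 1 + j - 1 + 1 = n + 1 + j by omega]
  rw [this]
  simp

/-- `∑_{i=1}^r P_{n-i} B_n^{(i)} = P_n A_n`, where `P` vanishes at negative indices. -/
theorem sum_P_mul_Bvec {r : ℕ} {a : ℕ → ℕ → ℂ} {A : ℕ → Fin r → ℂ[X]}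
    (hA0 : ∀ k : Fin r, A 0 k = 0)
    (hArec : ∀ n, 1 ≤ n → ∀ k : Fin r,
      X * A n k = A (n - 1) k +
        ∑ j ∈ Finset.range (r + 1), a (n + j - 1) j • A (n + j) k)
    {P : ℕ → ℂ[X]}
    (hPrec : ∀ n, X * P n = P (n + 1) +
      ∑ j ∈ Finset.range (r + 1), a n j • (if j ≤ n then P (n - j) else 0))
    (n : ℕ) (k : Fin r) :
    ∑ i ∈ Finset.range r,
      (if i + 1 ≤ n then P (n - (i + 1)) else 0) * Bvec r a A n (i + 1) k = P n * A n k := by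
  induction n with
  | zero => simp [hA0]
  | succ n ih =>
    have key : ∑ i ∈ Finset.range (r + 1),
        (if i + 1 ≤ n + 1 then P (n + 1 - (i + 1)) else 0) * Bvec r a A (n + 1) (i + 1) k =
        P (n + 1) * A (n + 1) k := by
      have h1 : ∀ i ∈ Finset.range r,
          (if i + 1 + 1 ≤ n + 1 then P (n + 1 - (i + 1 + 1)) else 0) *
            Bvec r a A (n + 1) (i + 1 + 1) k =
          (if i + 1 ≤ n then P (n - (i + 1)) else 0) * Bvec r a A n (i + 1) k -
          (a n (i + 1) • (if i + 1 ≤ n then P (n - (i + 1)) else 0)) * A (n + 1) k := by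
        intro i hi
        rw [Finset.mem_range] at hi
        rw [Bvec_succ_succ a A n (show i + 1 ≤ r by omega) k]
        simp only [Nat.add_le_add_iff_right, Nat.add_sub_add_right, smul_eq_C_mul]
        ring
      rw [Finset.sum_range_succ', Finset.sum_congr rfl h1, Finset.sum_sub_distrib, ih,
        ← Finset.sum_mul, Bvec_one hArec]
      have h2 := hPrec n
      rw [Finset.sum_range_succ'] at h2
      simp only [Nat.zero_le, if_true, Nat.sub_zero, zero_add, Nat.le_add_left,
        Nat.add_sub_cancel, smul_eq_C_mul] at h2 ⊢
      linear_combination A (n + 1) k * h2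
    rwa [Finset.sum_range_succ, Bvec_of_lt a A _ (Nat.lt_succ_self r), mul_zero, add_zero] at key

/-- The matrix with columns `B_n^{(1)}, …, B_n^{(r)}`. -/
noncomputable def Bmat (r : ℕ) (a : ℕ → ℕ → ℂ) (A : ℕ → Fin r → ℂ[X]) (n : ℕ) :
    Matrix (Fin r) (Fin r) ℂ[X] :=
  Matrix.of fun row col => Bvec r a A n (col.val + 1) row

theorem Qdet_eq_cramer {r : ℕ} (a : ℕ → ℕ → ℂ) (A : ℕ → Fin r → ℂ[X]) (n k : ℕ) (i : Fin r) :
    Qdet r a A n k (i.val + 1) = (Bmat r a A n).cramer (A k) i := by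
  rw [Matrix.cramer_apply, Qdet]
  congr 1
  ext row col : 2
  simp [Bmat, Matrix.updateCol_apply, Fin.ext_iff]

/-- Cramer's rule for the linear system of `sum_P_mul_Bvec`. -/
theorem P_mul_Qdet {r : ℕ} {a : ℕ → ℕ → ℂ} {A : ℕ → Fin r → ℂ[X]}
    (hA0 : ∀ k : Fin r, A 0 k = 0)
    (hArec : ∀ n, 1 ≤ n → ∀ k : Fin r,
      X * A n k = A (n - 1) k +
        ∑ j ∈ Finset.range (r + 1), a (n + j - 1) j • A (n + j) k)
    {P : ℕ → ℂ[X]}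
    (hPrec : ∀ n, X * P n = P (n + 1) +
      ∑ j ∈ Finset.range (r + 1), a n j • (if j ≤ n then P (n - j) else 0))
    (n : ℕ) (i : Fin r) :
    P n * Qdet r a A n n (i.val + 1) =
      (Bmat r a A n).det * (if i.val + 1 ≤ n then P (n - (i.val + 1)) else 0) := by
  set v : Fin r → ℂ[X] := fun i => if i.val + 1 ≤ n then P (n - (i.val + 1)) else 0
  have hv : (Bmat r a A n).mulVec v = P n • A n := by
    ext1 k
    have := sum_P_mul_Bvec hA0 hArec hPrec n k
    rw [Finset.sum_range] at this
    simp only [Matrix.mulVec, dotProduct, Bmat, Matrix.of_apply, v, Pi.smul_apply, smul_eq_mul]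
    rw [← this]
    exact Finset.sum_congr rfl fun _ _ => mul_comm _ _
  have h := congrArg (Matrix.cramer (Bmat r a A n)) hv
  rw [Matrix.cramer_eq_adjugate_mulVec, Matrix.mulVec_mulVec, Matrix.adjugate_mul,
    Matrix.smul_mulVec, Matrix.one_mulVec, map_smul] at h
  rw [Qdet_eq_cramer]
  exact (congrFun h i).symm

theorem C_mul_Qdet_succ_one {R : ℕ} {a : ℕ → ℕ → ℂ} {A : ℕ → Fin (R + 1) → ℂ[X]} {n : ℕ}
    (ha : a n (R + 1) ≠ 0) :
    C (a n (R + 1)) * Qdet (R + 1) a A (n + 1) (n + 1) 1 =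
      (-1) ^ R * (Bmat (R + 1) a A n).det := by
  have hQ := Qdet_eq_cramer a A (n + 1) (n + 1) 0
  rw [Fin.val_zero, zero_add, Matrix.cramer_apply] at hQ
  rw [hQ, ← Matrix.det_updateCol_smul]
  have hs : ((-1 : ℂ[X]) ^ R) = ((Equiv.Perm.sign (finRotate (R + 1)).symm : ℤˣ) : ℤ) := by
    rw [Equiv.Perm.sign_symm, sign_finRotate]
    simp
  rw [hs, ← Matrix.det_permute']
  rw [← Matrix.det_transpose, ← Matrix.det_transpose (Matrix.submatrix _ _ _)]
  symm
  refine Matrix.det_eq_of_forall_row_eq_smul_add_const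
    (fun j => if j = 0 then 0 else C (a n j.val / a n (R + 1))) 0 (by simp) ?_
  intro j i
  have hlast : Bvec (R + 1) a A n (R + 1) i = C (a n (R + 1)) * A (n + 1) i := by
    rw [Bvec_succ_succ a A n le_rfl, Bvec_of_lt a A _ (by omega), add_zero, smul_eq_C_mul]
  refine Fin.cases ?_ (fun j => ?_) j
  · have : (finRotate (R + 1)).symm 0 = Fin.last R := by
      rw [Equiv.symm_apply_eq, finRotate_last]
    simp [Bmat, this, hlast]
  · have : (finRotate (R + 1)).symm j.succ = j.castSucc := by
      rw [Equiv.symm_apply_eq, finRotate_apply, Fin.coeSucc_eq_succ]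
    simp only [Matrix.transpose_apply, Matrix.submatrix_apply, this, Bmat, Matrix.of_apply, id, Fin.val_castSucc,
      Fin.succ_ne_zero, if_false, Matrix.updateCol_self, Pi.smul_apply, smul_eq_mul, ne_eq,
      not_false_eq_true, Matrix.updateCol_ne, Fin.val_succ]
    rw [Bvec_succ_succ a A n (by omega), ← mul_assoc, ← C_mul, div_mul_cancel₀ _ ha,
      smul_eq_C_mul, add_comm]

theorem sign_revPerm (n : ℕ) :
    Equiv.Perm.sign (Fin.revPerm : Equiv.Perm (Fin n)) = (-1) ^ (n / 2) := by
  have h : ∀ j : Fin n, ∏ i ∈ Finset.Iio j,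
      (if (Fin.revPerm i : Fin n) < Fin.revPerm j then (1 : ℤˣ) else -1) = (-1) ^ j.val := by
    intro j
    rw [Finset.prod_congr rfl fun i hi => if_neg ?_, Finset.prod_const, Fin.card_Iio]
    rw [Finset.mem_Iio] at hi
    simpa using hi.le
  rw [Equiv.Perm.sign_eq_prod_prod_Iio, Finset.prod_congr rfl fun j _ => h j,
    Finset.prod_pow_eq_pow_sum, ← Finset.sum_range fun i => i]
  clear h
  induction n using Nat.twoStepInduction with
  | zero => rfl
  | one => rfl
  | more n ih _ =>
    rw [Finset.sum_range_succ, Finset.sum_range_succ, add_assoc, pow_add, ih,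
      ← add_assoc, ← two_mul, pow_succ (-1 : ℤˣ) (2 * n), pow_mul]
    simp [pow_succ]

theorem det_Bmat_zero {r : ℕ} {a : ℕ → ℕ → ℂ}
    (hconv : ∀ ℓ1 ℓ2 : ℕ, ℓ1 < ℓ2 → ℓ2 ≤ r → a ℓ1 ℓ2 = 1)
    {A : ℕ → Fin r → ℂ[X]}
    (hAconst : ∀ i j : Fin r, (A (i.val + 1) j).degree ≤ 0)
    (hAtri : ∀ i j : Fin r, i.val < j.val → A (i.val + 1) j = 0) :
    (Bmat r a A 0).det = C ((∏ j : Fin r, (A (j.val + 1) j).coeff 0) * (-1) ^ (r / 2)) := by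
  have hdet : (Matrix.of fun row col : Fin r => A (col.val + 1) row).det =
      C (∏ j : Fin r, (A (j.val + 1) j).coeff 0) := by
    rw [Matrix.det_of_isUpperTriangular, map_prod]
    · exact Finset.prod_congr rfl fun j _ => eq_C_of_degree_le_zero (hAconst j j)
    · intro i j hij
      exact hAtri j i hij
  have hB : ∀ i, 1 ≤ i → i ≤ r → ∀ k,
      Bvec r a A 0 i k = ∑ t ∈ Finset.range (r + 1 - i), A (t + 1) k := by
    intro i hi hir k
    unfold Bvec
    rw [← Finset.Ico_add_one_right_eq_Icc, Finset.sum_Ico_eq_sum_range]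
    refine Finset.sum_congr rfl fun t ht => ?_
    rw [Finset.mem_range] at ht
    rw [hconv _ _ (by omega) (by omega), one_smul, show 0 + (i + t) - i = t by omega]
  have hrev : ((Bmat r a A 0).submatrix id Fin.revPerm).det =
      (Matrix.of fun row col : Fin r => A (col.val + 1) row).det := by
    obtain _ | R := r
    · simp
    refine Matrix.det_eq_of_forall_col_eq_smul_add_pred (fun _ => 1) ?_ ?_
    · intro i
      simp only [Matrix.submatrix_apply, Bmat, Matrix.of_apply, id, Fin.revPerm_apply, Fin.rev_zero,
        Fin.val_last, Fin.val_zero]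
      rw [hB _ (by omega) le_rfl]
      simp
    · intro i j
      simp only [Matrix.submatrix_apply, Bmat, Matrix.of_apply, id, Fin.revPerm_apply, Fin.val_rev,
        Fin.val_succ, Fin.val_castSucc, one_mul]
      rw [hB _ (by omega) (by omega), hB _ (by omega) (by omega),
        show R + 1 + 1 - (R + 1 - (j.val + 1 + 1) + 1) = j.val + 1 + 1 by omega,
        show R + 1 + 1 - (R + 1 - (j.val + 1) + 1) = j.val + 1 by omega,
        Finset.sum_range_succ _ (j.val + 1), add_comm]
  rw [Matrix.det_permute', hdet, sign_revPerm] at hrev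
  rw [map_mul, ← hrev]
  simp only [Units.val_pow_eq_pow_val, Units.val_neg, Units.val_one, Int.cast_pow, Int.cast_neg,
    Int.cast_one, map_pow, map_neg, map_one]
  rw [mul_right_comm, ← mul_pow]
  simp

theorem P_monic_natDegree {r : ℕ} {a : ℕ → ℕ → ℂ} {P : ℕ → ℂ[X]} (hP0 : P 0 = 1)
    (hPrec : ∀ n, X * P n = P (n + 1) +
      ∑ j ∈ Finset.range (r + 1), a n j • (if j ≤ n then P (n - j) else 0)) (n : ℕ) :
    (P n).Monic ∧ (P n).natDegree = n := by
  induction n using Nat.strong_induction_on with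
  | _ n ih =>
    obtain _ | n := n
    · simp [hP0]
    obtain ⟨hm, hd⟩ := ih n (by omega)
    have hXm : (X * P n).Monic := monic_X.mul hm
    have hXd : (X * P n).natDegree = n + 1 := by
      rw [monic_X.natDegree_mul hm, natDegree_X, hd, add_comm]
    have hlt : (∑ j ∈ Finset.range (r + 1), a n j • (if j ≤ n then P (n - j) else 0)).degree <
        (X * P n).degree := by
      rw [degree_eq_natDegree hXm.ne_zero, hXd]
      refine (degree_sum_le _ _).trans_lt ((Finset.sup_lt_iff (WithBot.bot_lt_coe _)).2 ?_)
      intro j _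
      refine (degree_smul_le _ _).trans_lt ?_
      split_ifs with hj
      · obtain ⟨-, hd'⟩ := ih (n - j) (by omega)
        refine degree_le_natDegree.trans_lt ?_
        rw [hd']
        exact_mod_cast (by omega : n - j < n + 1)
      · simp
    rw [eq_sub_of_add_eq (hPrec n).symm]
    exact ⟨hXm.sub_of_left hlt,
      (natDegree_eq_of_degree_eq (degree_sub_eq_left_of_degree_lt hlt)).trans hXd⟩

theorem det_Bmat {r : ℕ} (hr : 0 < r) {a : ℕ → ℕ → ℂ}
    (hconv : ∀ ℓ1 ℓ2 : ℕ, ℓ1 < ℓ2 → ℓ2 ≤ r → a ℓ1 ℓ2 = 1)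
    (har : ∀ ℓ, r ≤ ℓ → a ℓ r ≠ 0)
    {A : ℕ → Fin r → ℂ[X]}
    (hA0 : ∀ k : Fin r, A 0 k = 0)
    (hAconst : ∀ i j : Fin r, (A (i.val + 1) j).degree ≤ 0)
    (hAtri : ∀ i j : Fin r, i.val < j.val → A (i.val + 1) j = 0)
    (hArec : ∀ n, 1 ≤ n → ∀ k : Fin r,
      X * A n k = A (n - 1) k +
        ∑ j ∈ Finset.range (r + 1), a (n + j - 1) j • A (n + j) k)
    {P : ℕ → ℂ[X]} (hP0 : P 0 = 1)
    (hPrec : ∀ n, X * P n = P (n + 1) +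
      ∑ j ∈ Finset.range (r + 1), a n j • (if j ≤ n then P (n - j) else 0)) (n : ℕ) :
    (Bmat r a A n).det =
      C (((∏ j : Fin r, (A (j.val + 1) j).coeff 0) / ∏ ℓ ∈ Finset.Ico r n, a ℓ r) *
        (-1) ^ (r / 2 + (r - 1) * n)) * P n := by
  obtain ⟨R, rfl⟩ : ∃ R, r = R + 1 := ⟨r - 1, by omega⟩
  induction n with
  | zero => simp [det_Bmat_zero hconv hAconst hAtri, hP0]
  | succ n ih =>
    have hprod : ∏ ℓ ∈ Finset.Ico (R + 1) (n + 1), a ℓ (R + 1) =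
        (∏ ℓ ∈ Finset.Ico (R + 1) n, a ℓ (R + 1)) * a n (R + 1) := by
      obtain h | h := le_or_gt (R + 1) n
      · exact Finset.prod_Ico_succ_top h _
      · rw [Finset.Ico_eq_empty (by omega), Finset.Ico_eq_empty (by omega),
          hconv _ _ h le_rfl, Finset.prod_empty, mul_one]
    have ha : a n (R + 1) ≠ 0 := by
      obtain h | h := le_or_gt (R + 1) n
      · exact har n h
      · simp [hconv _ _ h le_rfl]
    have h1 := P_mul_Qdet hA0 hArec hPrec (n + 1) 0
    have h2 := C_mul_Qdet_succ_one (A := A) ha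
    simp only [Fin.val_zero, zero_add, Nat.le_add_left, if_true, Nat.add_sub_cancel] at h1
    have hP := (P_monic_natDegree hP0 hPrec n).1.ne_zero
    refine mul_right_cancel₀ (mul_ne_zero hP (C_ne_zero.2 ha)) ?_
    rw [hprod]
    set c := (∏ j : Fin (R + 1), (A (j.val + 1) j).coeff 0)
    set d := ∏ ℓ ∈ Finset.Ico (R + 1) n, a ℓ (R + 1)
    have hc : C (c / (d * a n (R + 1)) * (-1) ^ ((R + 1) / 2 + (R + 1 - 1) * (n + 1))) *
        C (a n (R + 1)) = C (c / d * (-1) ^ ((R + 1) / 2 + (R + 1 - 1) * n)) * (-1) ^ R := by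
      rw [← C_mul, show (-1 : ℂ[X]) ^ R = C ((-1) ^ R) by simp, ← C_mul]
      congr 1
      rw [div_mul_eq_div_div, Nat.add_sub_cancel, mul_add, mul_one, ← add_assoc, pow_add _ _ R]
      field_simp
    rw [ih] at h2
    linear_combination (-C (a n (R + 1))) * h1 + P (n + 1) * h2 - P (n + 1) * P n * hc

theorem neg_one_pow_half_add_pred_mul {r m s : ℕ} (hs : 0 < s) (hsr : s ≤ r) :
    (-1 : ℂ) ^ (r / 2 + (r - 1) * (m * r + s)) = (-1) ^ (s / 2 + (r - s) / 2) := by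
  obtain ⟨t, rfl⟩ := Nat.exists_eq_add_of_le hsr
  obtain ⟨s, rfl⟩ : ∃ u, s = u + 1 := ⟨s - 1, by omega⟩
  rw [neg_one_pow_congr]
  rw [show s + 1 + t - 1 = s + t by omega, show s + 1 + t - (s + 1) = t by omega]
  have he : Even ((s + t) * (m * (s + 1 + t))) := by
    have := Nat.even_mul_succ_self (s + t)
    convert this.mul_left m using 1
    ring
  rw [mul_add, ← add_assoc, add_right_comm, Nat.even_add (n := (s + t) * (m * _))]
  simp only [he, iff_true]
  generalize hp : (s + 1 + t) / 2 = p
  generalize hq : (s + 1) / 2 = q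
  generalize hw : t / 2 = w
  simp only [Nat.even_add, Nat.even_mul]
  simp only [Nat.even_iff]
  omega

/-- `Q^{(i)}_{n,n}(y) = γ_n P_{n−i}(y)` for `i = 1,…,min(r,n)`, where
`γ_n = (∏_{j=1}^r A_{j,j} / ∏_{ℓ=r}^{n−1} a_{ℓ,r}) (−1)^{⌊s/2⌋+⌊(r−s)/2⌋}`, `n = mr+s`,
`0 < s ≤ r`. -/
theorem Qdet_diag_eq_gamma_mul_P (r : ℕ) (hr : 0 < r) (a : ℕ → ℕ → ℂ)
    (hconv : ∀ ℓ1 ℓ2 : ℕ, ℓ1 < ℓ2 → ℓ2 ≤ r → a ℓ1 ℓ2 = 1)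
    (har : ∀ ℓ, r ≤ ℓ → a ℓ r ≠ 0)
    (A : ℕ → Fin r → Polynomial ℂ)
    (hA0 : ∀ k : Fin r, A 0 k = 0)
    (hAconst : ∀ i j : Fin r, (A (i.val + 1) j).degree ≤ 0)
    (hAtri : ∀ i j : Fin r, i.val < j.val → A (i.val + 1) j = 0)
    (hAdiag : ∀ j : Fin r, A (j.val + 1) j ≠ 0)
    (hArec : ∀ n, 1 ≤ n → ∀ k : Fin r,
      X * A n k = A (n - 1) k +
        ∑ j ∈ Finset.range (r + 1), a (n + j - 1) j • A (n + j) k)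
    (P : ℕ → Polynomial ℂ) (hP0 : P 0 = 1)
    (hPrec : ∀ n, X * P n = P (n + 1) +
      ∑ j ∈ Finset.range (r + 1), a n j • (if j ≤ n then P (n - j) else 0)) :
    ∀ n m s : ℕ, 0 < s → s ≤ r → n = m * r + s →
      ∀ i : ℕ, 1 ≤ i → i ≤ min r n →
        Qdet r a A n n i =
          C (((∏ j : Fin r, (A (j.val + 1) j).coeff 0) / ∏ ℓ ∈ Finset.Ico r n, a ℓ r) *
              (-1) ^ (s / 2 + (r - s) / 2)) * P (n - i) := by
  intro n m s hs hsr hn i hi hin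
  obtain ⟨i, rfl⟩ : ∃ j, i = j + 1 := ⟨i - 1, by omega⟩
  have h := P_mul_Qdet hA0 hArec hPrec n ⟨i, by omega⟩
  rw [det_Bmat hr hconv har hA0 hAconst hAtri hArec hP0 hPrec, if_pos (by simp only; omega)] at h
  refine mul_left_cancel₀ (P_monic_natDegree hP0 hPrec n).1.ne_zero (h.trans ?_)
  rw [← neg_one_pow_half_add_pred_mul (m := m) hs hsr, ← hn]
  ring
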